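/- Restricted eigenvalue condition for the Fourier basis (the paper's restricted eigenvalue lemma, instantiated uniformly in the fragment location for the Fourier basis used in its main theorems): for every integer r ≥ 1 and every δ ∈ (0,1], there exists a constant ζ > 0 such that for every a ∈ [0, 1−δ] and every matrix Δ ∈ ℝ^{r×r}, (1/δ²) ∫_a^{a+δ} ∫_a^{a+δ} (Φ_r(s)ᵀ Δ Φ_r(u))² ds du ≥ ζ ‖Δ‖_F². -/

import Mathlib

/-- The Fourier basis on `[0,1]` (1-indexed): `φ₁ = 1`, `φ_{2k} t = cos (2kπt)`,
`φ_{2k+1} t = sin (2kπt)` for `k ≥ 1`. -/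
noncomputable def fourierPhi (k : ℕ) (t : ℝ) : ℝ :=
  if k = 1 then 1
  else if k % 2 = 0 then Real.cos (2 * ((k / 2 : ℕ) : ℝ) * Real.pi * t)
  else Real.sin (2 * ((k / 2 : ℕ) : ℝ) * Real.pi * t)

/-- The phase `θ` for which `fourierPhi k t = cos (2 (k / 2) π t - θ)`. -/
noncomputable def fourierPhase (k : ℕ) : ℝ :=
  if k = 1 ∨ k % 2 = 0 then 0 else Real.pi / 2

theorem fourierPhi_eq_cos (k : ℕ) (t : ℝ) :
    fourierPhi k t = Real.cos (2 * ((k / 2 : ℕ) : ℝ) * Real.pi * t - fourierPhase k) := by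
  unfold fourierPhi fourierPhase
  by_cases h1 : k = 1
  · simp [h1]
  · by_cases h2 : k % 2 = 0
    · simp [h1, h2]
    · simp only [h1, h2, if_false, or_self, Real.cos_sub_pi_div_two]

theorem analyticAt_fourierPhi (k : ℕ) (t : ℝ) : AnalyticAt ℝ (fourierPhi k) t := by
  rw [funext (fourierPhi_eq_cos k)]
  fun_prop

theorem continuous_fourierPhi (k : ℕ) : Continuous (fourierPhi k) := by
  rw [funext (fourierPhi_eq_cos k)]
  fun_prop

theorem integral_cos_two_pi_int_mul_sub (n : ℤ) (θ : ℝ) :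
    ∫ t in (0 : ℝ)..1, Real.cos (2 * (n : ℝ) * Real.pi * t - θ) =
      if n = 0 then Real.cos θ else 0 := by
  split_ifs with h
  · simp [h]
  · have hn : (2 * (n : ℝ) * Real.pi) ≠ 0 := by
      have : (n : ℝ) ≠ 0 := by exact_mod_cast h
      positivity
    rw [intervalIntegral.integral_comp_mul_sub (fun x => Real.cos x) hn θ, integral_cos]
    have : 2 * (n : ℝ) * Real.pi * 1 - θ = -θ + n * (2 * Real.pi) := by ring
    rw [this, Real.sin_add_int_mul_two_pi]
    simp

theorem integral_fourierPhi_mul (k l : ℕ) :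
    ∫ t in (0 : ℝ)..1, fourierPhi k t * fourierPhi l t =
      ((if ((k / 2 : ℕ) : ℤ) - (l / 2 : ℕ) = 0 then
          Real.cos (fourierPhase k - fourierPhase l) else 0) +
        (if ((k / 2 : ℕ) : ℤ) + (l / 2 : ℕ) = 0 then
          Real.cos (fourierPhase k + fourierPhase l) else 0)) / 2 := by
  rw [← integral_cos_two_pi_int_mul_sub, ← integral_cos_two_pi_int_mul_sub,
    ← intervalIntegral.integral_add
      (Continuous.intervalIntegrable (by fun_prop) _ _)
      (Continuous.intervalIntegrable (by fun_prop) _ _),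
    ← intervalIntegral.integral_div]
  refine intervalIntegral.integral_congr fun t _ => ?_
  simp only [fourierPhi_eq_cos]
  set x := 2 * ((k / 2 : ℕ) : ℝ) * Real.pi * t - fourierPhase k
  set y := 2 * ((l / 2 : ℕ) : ℝ) * Real.pi * t - fourierPhase l
  have h₁ : 2 * ((((k / 2 : ℕ) : ℤ) - ((l / 2 : ℕ) : ℤ) : ℤ) : ℝ) * Real.pi * t -
      (fourierPhase k - fourierPhase l) = x - y := by
    rw [Int.cast_sub, Int.cast_natCast, Int.cast_natCast]; ring
  have h₂ : 2 * ((((k / 2 : ℕ) : ℤ) + ((l / 2 : ℕ) : ℤ) : ℤ) : ℝ) * Real.pi * t -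
      (fourierPhase k + fourierPhase l) = x + y := by
    rw [Int.cast_add, Int.cast_natCast, Int.cast_natCast]; ring
  rw [h₁, h₂, Real.cos_sub x y, Real.cos_add x y]
  ring

theorem integral_fourierPhi_mul_of_ne {k l : ℕ} (hk : 1 ≤ k) (hl : 1 ≤ l) (h : k ≠ l) :
    ∫ t in (0 : ℝ)..1, fourierPhi k t * fourierPhi l t = 0 := by
  rw [integral_fourierPhi_mul, if_neg (by omega : ¬((k / 2 : ℕ) : ℤ) + (l / 2 : ℕ) = 0)]
  split_ifs with hkl
  · unfold fourierPhase
    rcases Nat.mod_two_eq_zero_or_one k with hk2 | hk2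
    · rw [if_pos (Or.inr hk2), if_neg (by omega)]
      simp
    · rw [if_neg (by omega), if_pos (by omega)]
      simp
  · simp

theorem integral_fourierPhi_mul_self_pos {k : ℕ} (hk : 1 ≤ k) :
    0 < ∫ t in (0 : ℝ)..1, fourierPhi k t * fourierPhi k t := by
  rw [integral_fourierPhi_mul]
  split_ifs with h₁ h₂ h₂
  · simp [fourierPhase, (by omega : k = 1)]
  · simp
  · omega
  · omega

theorem eq_zero_of_sum_fourierPhi_eq_zero {r : ℕ} {v : Fin r → ℝ}
    (h : ∀ t, ∑ l : Fin r, v l * fourierPhi (l.1 + 1) t = 0) : v = 0 := by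
  funext m
  have hsum : ∑ l : Fin r,
      v l * ∫ t in (0 : ℝ)..1, fourierPhi (l.1 + 1) t * fourierPhi (m.1 + 1) t = 0 := by
    simp_rw [← intervalIntegral.integral_const_mul]
    have hφ := continuous_fourierPhi
    rw [← intervalIntegral.integral_finsetSum fun l _ =>
      Continuous.intervalIntegrable (by fun_prop) _ _]
    simp_rw [← mul_assoc, ← Finset.sum_mul, h]
    simp
  rw [Finset.sum_eq_single m] at hsum
  · exact (mul_eq_zero.mp hsum).resolve_right
      (integral_fourierPhi_mul_self_pos (by omega)).ne'
  · intro l _ hl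
    rw [integral_fourierPhi_mul_of_ne (by omega) (by omega)
      (by simpa [Fin.ext_iff] using hl), mul_zero]
  · simp

/-- The Gram matrix of the Fourier basis on a fragment of positive length is positive definite. -/
theorem integral_sum_fourierPhi_sq_pos {r : ℕ} {v : Fin r → ℝ} (hv : v ≠ 0) {a b : ℝ}
    (hab : a < b) :
    0 < ∫ t in a..b, (∑ l : Fin r, v l * fourierPhi (l.1 + 1) t) ^ 2 := by
  have hcont : Continuous fun t => (∑ l : Fin r, v l * fourierPhi (l.1 + 1) t) ^ 2 := by
    have := continuous_fourierPhi
    fun_prop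
  refine intervalIntegral.integral_pos hab hcont.continuousOn (fun t _ => sq_nonneg _) ?_
  by_contra! hle
  have hzero : ∀ t ∈ Set.Icc a b, ∑ l : Fin r, v l * fourierPhi (l.1 + 1) t = 0 :=
    fun t ht => pow_eq_zero_iff two_ne_zero |>.mp (le_antisymm (hle t ht) (sq_nonneg _))
  have hanalytic : AnalyticOnNhd ℝ
      (fun t => ∑ l : Fin r, v l * fourierPhi (l.1 + 1) t) Set.univ := fun t _ =>
    Finset.univ.analyticAt_fun_sum fun l _ => analyticAt_const.mul (analyticAt_fourierPhi _ t)
  have hev : (fun t => ∑ l : Fin r, v l * fourierPhi (l.1 + 1) t)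
      =ᶠ[nhds ((a + b) / 2)] fun _ => 0 := by
    filter_upwards [Icc_mem_nhds (by linarith : a < (a + b) / 2)
      (by linarith : (a + b) / 2 < b)] with t ht using hzero t ht
  exact hv (eq_zero_of_sum_fourierPhi_eq_zero fun t =>
    congrFun (hanalytic.eq_of_eventuallyEq analyticOnNhd_const hev) t)

/-- The smallest eigenvalue of the Gram matrix of the Fourier basis on `[a, a + δ]` is bounded
away from zero uniformly in `a`. -/
theorem exists_pos_forall_mul_sum_sq_le_integral_sum_fourierPhi_sq (r : ℕ) {δ : ℝ}
    (hδ : 0 < δ) :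
    ∃ c : ℝ, 0 < c ∧ ∀ a ∈ Set.Icc (0 : ℝ) (1 - δ), ∀ v : Fin r → ℝ,
      c * ∑ l, v l ^ 2 ≤
        ∫ t in a..(a + δ), (∑ l : Fin r, v l * fourierPhi (l.1 + 1) t) ^ 2 := by
  let F : ℝ × EuclideanSpace ℝ (Fin r) → ℝ := fun p =>
    ∫ t in (0 : ℝ)..δ, (∑ l : Fin r, p.2 l * fourierPhi (l.1 + 1) (p.1 + t)) ^ 2
  have hF : ∀ a w, F (a, w) =
      ∫ t in a..(a + δ), (∑ l : Fin r, w l * fourierPhi (l.1 + 1) t) ^ 2 := fun a w => by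
    simpa using intervalIntegral.integral_comp_add_left (a := 0) (b := δ)
      (fun t => (∑ l : Fin r, w l * fourierPhi (l.1 + 1) t) ^ 2) a
  have hFcont : Continuous F := by
    refine intervalIntegral.continuous_parametric_intervalIntegral_of_continuous'
      (f := fun (p : ℝ × EuclideanSpace ℝ (Fin r)) t =>
        (∑ l : Fin r, p.2 l * fourierPhi (l.1 + 1) (p.1 + t)) ^ 2) ?_ 0 δ
    have := continuous_fourierPhi
    unfold Function.uncurry
    fun_prop
  obtain ⟨c, hc, hcF⟩ := (isCompact_Icc.prod
    (isCompact_sphere (0 : EuclideanSpace ℝ (Fin r)) 1)).exists_forall_le'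
    (s := Set.Icc (0 : ℝ) (1 - δ) ×ˢ Metric.sphere (0 : EuclideanSpace ℝ (Fin r)) 1)
    hFcont.continuousOn (a := 0) (by
      rintro ⟨a, w⟩ ⟨-, hw⟩
      rw [hF]
      refine integral_sum_fourierPhi_sq_pos (fun h => ?_) (by linarith)
      have hw0 : w = 0 := by ext i; exact congrFun h i
      simp [hw0] at hw)
  refine ⟨c, hc, fun a ha v => ?_⟩
  by_cases hv : WithLp.toLp 2 v = 0
  · have hv0 : v = 0 := by simpa using hv
    simp [hv0]
  set w : EuclideanSpace ℝ (Fin r) := WithLp.toLp 2 v with hw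
  have hnorm : 0 < ‖w‖ := norm_pos_iff.mpr hv
  have hle := hcF (a, ‖w‖⁻¹ • w) ⟨ha, by simp [norm_smul, hnorm.ne']⟩
  have hsq : ∑ l, v l ^ 2 = ‖w‖ ^ 2 := by rw [EuclideanSpace.real_norm_sq_eq]
  have hscale : F (a, ‖w‖⁻¹ • w) = (‖w‖ ^ 2)⁻¹ *
      ∫ t in a..(a + δ), (∑ l : Fin r, v l * fourierPhi (l.1 + 1) t) ^ 2 := by
    rw [hF, ← intervalIntegral.integral_const_mul]
    refine intervalIntegral.integral_congr fun t _ => ?_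
    simp only [PiLp.smul_apply, smul_eq_mul, mul_assoc, ← Finset.mul_sum, mul_pow, inv_pow, hw]
  rw [hscale, inv_mul_eq_div, le_div_iff₀ (by positivity)] at hle
  rwa [hsq]

/-- Restricted eigenvalue condition for the Fourier basis: for every `r ≥ 1` and `δ ∈ (0,1]`
there is `ζ > 0` such that for every fragment location `a ∈ [0, 1-δ]` and every matrix
`Δ ∈ ℝ^{r×r}`,
`(1/δ²) ∫_a^{a+δ} ∫_a^{a+δ} (Φ_r(s)ᵀ Δ Φ_r(u))² ds du ≥ ζ ‖Δ‖_F²`. -/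
theorem fourier_restricted_eigenvalue
    (r : ℕ) (hr : 1 ≤ r) (δ : ℝ) (hδ0 : 0 < δ) (hδ1 : δ ≤ 1) :
    ∃ ζ : ℝ, 0 < ζ ∧
      ∀ a : ℝ, a ∈ Set.Icc (0 : ℝ) (1 - δ) →
      ∀ Δ : Matrix (Fin r) (Fin r) ℝ,
        ζ * (∑ h : Fin r, ∑ l : Fin r, (Δ h l) ^ 2) ≤
          (1 / δ ^ 2) *
            ∫ s in a..(a + δ), ∫ u in a..(a + δ),
              (∑ h : Fin r, ∑ l : Fin r,
                Δ h l * fourierPhi (h.1 + 1) s * fourierPhi (l.1 + 1) u) ^ 2 := by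
  obtain ⟨c, hc, hbound⟩ := exists_pos_forall_mul_sum_sq_le_integral_sum_fourierPhi_sq r hδ0
  refine ⟨1 / δ ^ 2 * c ^ 2, by positivity, fun a ha Δ => ?_⟩
  rw [mul_assoc]
  refine mul_le_mul_of_nonneg_left ?_ (by positivity)
  have hφ := continuous_fourierPhi
  have hsum : ∀ s u, ∑ h : Fin r, ∑ l : Fin r,
      Δ h l * fourierPhi (h.1 + 1) s * fourierPhi (l.1 + 1) u =
        ∑ l : Fin r, (∑ h : Fin r, Δ h l * fourierPhi (h.1 + 1) s) * fourierPhi (l.1 + 1) u :=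
    fun s u => by
      simp_rw [Finset.sum_mul]
      exact Finset.sum_comm
  simp_rw [hsum]
  calc c ^ 2 * ∑ h : Fin r, ∑ l : Fin r, Δ h l ^ 2
      = c * ∑ l : Fin r, c * ∑ h : Fin r, Δ h l ^ 2 := by
        rw [Finset.sum_comm, ← Finset.mul_sum]; ring
    _ ≤ c * ∑ l : Fin r,
          ∫ s in a..(a + δ), (∑ h : Fin r, Δ h l * fourierPhi (h.1 + 1) s) ^ 2 := by
        gcongr with l
        exact hbound a ha fun h => Δ h l
    _ = ∫ s in a..(a + δ),
          c * ∑ l : Fin r, (∑ h : Fin r, Δ h l * fourierPhi (h.1 + 1) s) ^ 2 := by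
        rw [intervalIntegral.integral_const_mul, intervalIntegral.integral_finsetSum]
        exact fun l _ => Continuous.intervalIntegrable (by fun_prop) _ _
    _ ≤ _ := by
        refine intervalIntegral.integral_mono_on (by linarith)
          (Continuous.intervalIntegrable (by fun_prop) _ _)
          (Continuous.intervalIntegrable ?_ _ _) fun s _ => hbound a ha _
        refine intervalIntegral.continuous_parametric_intervalIntegral_of_continuous'
          (f := fun s u => (∑ l : Fin r,
            (∑ h : Fin r, Δ h l * fourierPhi (h.1 + 1) s) * fourierPhi (l.1 + 1) u) ^ 2) ?_ _ _
        unfold Function.uncurry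
        fun_prop
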